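/- arXiv:2112.09050 — 6 statements merged into one kernel-verified Lean document; each statement's English description precedes it below -/
import Mathlib

section
/- For the uniform mixing setup with a = 0, φ_l = φ_l^{(0)} and U_l(x) = ∫_0^x φ_l(z)dz + x φ_l(x): for any fixed 0 < a_0 < b_0 < ∞, there exists a constant c > 0 (depending only on a_0 and b_0) such that for every integer l ≥ 0, ∫_{a_0}^{b_0} U_l^2(x)dx ≤ c. -/
open MeasureTheory Real

/-- Generalized Laguerre polynomial `L_k^{(a)}(x)`. -/
noncomputable def genLagPoly (a : ℝ) (k : ℕ) (x : ℝ) : ℝ :=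
  ∑ i ∈ Finset.range (k + 1),
    (-1 : ℝ) ^ i * (Real.Gamma ((k : ℝ) + a + 1) /
      (Real.Gamma (a + i + 1) * (Nat.factorial (k - i)))) * x ^ i / (Nat.factorial i)

/-- Generalized Laguerre function `φ_k^{(a)}(x)`. -/
noncomputable def lagFun (a : ℝ) (k : ℕ) (x : ℝ) : ℝ :=
  Real.sqrt ((Nat.factorial k : ℝ) / Real.Gamma ((k : ℝ) + a + 1)) *
    Real.exp (-x / 2) * x ^ (a / 2) * genLagPoly a k x

/-- `U_l` for the uniform mixing distribution: `U_l(x) = ∫_0^x φ_l + x φ_l(x)`, with `a = 0`. -/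
noncomputable def Uunif (l : ℕ) (x : ℝ) : ℝ :=
  (∫ z in Set.Ioo (0 : ℝ) x, lagFun 0 l z) + x * lagFun 0 l x

open Polynomial in
/-- The Laguerre polynomial of degree `n`, as a formal polynomial. -/
noncomputable def laguerre (n : ℕ) : ℝ[X] :=
  ∑ i ∈ Finset.range (n + 1), Polynomial.monomial i ((-1 : ℝ) ^ i * n.choose i / i.factorial)

open Polynomial in
theorem coeff_laguerre (n m : ℕ) :
    (laguerre n).coeff m = (-1 : ℝ) ^ m * n.choose m / m.factorial := by
  simp only [laguerre, finsetSum_coeff, coeff_monomial, Finset.sum_ite_eq', Finset.mem_range]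
  split_ifs with h
  · rfl
  · simp [Nat.choose_eq_zero_of_lt (show n < m by omega)]

theorem genLagPoly_zero_eq_eval (n : ℕ) (x : ℝ) : genLagPoly 0 n x = (laguerre n).eval x := by
  simp only [genLagPoly, laguerre, Polynomial.eval_finsetSum, Polynomial.eval_monomial]
  refine Finset.sum_congr rfl fun i hi => ?_
  have hin : i ≤ n := Nat.lt_succ_iff.mp (Finset.mem_range.mp hi)
  rw [add_zero, zero_add, Real.Gamma_nat_eq_factorial, Real.Gamma_nat_eq_factorial,
    Nat.cast_choose ℝ hin]
  ring

open Polynomial in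
/-- Laguerre's differential equation. -/
theorem laguerre_ode (n : ℕ) :
    X * derivative (derivative (laguerre n)) + (1 - X) * derivative (laguerre n)
      + C (n : ℝ) * laguerre n = 0 := by
  have recur (m : ℕ) : ((m : ℝ) + 1) ^ 2 * (laguerre n).coeff (m + 1)
      + (n - m) * (laguerre n).coeff m = 0 := by
    have hc : (n.choose (m + 1) : ℝ) * (m + 1) = n.choose m * (n - m) := by
      rcases le_or_gt m n with h | h
      · have := congrArg (Nat.cast (R := ℝ)) (Nat.choose_succ_right_eq n m)
        push_cast [Nat.cast_sub h] at this
        exact this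
      · simp [Nat.choose_eq_zero_of_lt h, Nat.choose_eq_zero_of_lt (show n < m + 1 by omega)]
    rw [coeff_laguerre, coeff_laguerre, Nat.factorial_succ]
    push_cast
    have : (m.factorial : ℝ) ≠ 0 := by positivity
    have : (m : ℝ) + 1 ≠ 0 := by positivity
    field_simp
    rw [pow_succ]
    linear_combination (-(-1 : ℝ) ^ m) * hc
  ext m
  rw [sub_mul, one_mul]
  rcases m with _ | m
  · have := recur 0
    simp [coeff_derivative] at this ⊢
    linarith
  · have := recur (m + 1)
    simp only [coeff_add, coeff_sub, coeff_X_mul, coeff_C_mul, coeff_derivative, coeff_zero]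
    push_cast at this ⊢
    linarith

open Polynomial in
/-- The energy `n L² + x L'²`, damped by `exp (-2x)`, does not increase on `[0, ∞)`. -/
theorem antitoneOn_laguerre_energy (n : ℕ) :
    AntitoneOn (fun x : ℝ => (n * (laguerre n).eval x ^ 2
      + x * (derivative (laguerre n)).eval x ^ 2) * exp (-2 * x)) (Set.Ici 0) := by
  set p := laguerre n with hp
  have hd (x : ℝ) : HasDerivAt (fun x : ℝ => (n * p.eval x ^ 2
      + x * (derivative p).eval x ^ 2) * exp (-2 * x))
      (-(2 * n * p.eval x ^ 2 + (derivative p).eval x ^ 2) * exp (-2 * x)) x := by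
    have ode := congrArg (Polynomial.eval x) (laguerre_ode n)
    simp only [← hp, eval_add, eval_mul, eval_X, eval_sub, eval_one, eval_C, eval_zero] at ode
    have h0 := p.hasDerivAt x
    have h1 := (derivative p).hasDerivAt x
    have he : HasDerivAt (fun x : ℝ => exp (-2 * x)) (exp (-2 * x) * (-2 * 1)) x :=
      ((hasDerivAt_id x).const_mul (-2)).exp
    refine ((((h0.pow 2).const_mul (n : ℝ)).add ((hasDerivAt_id x).mul (h1.pow 2))).mul
      he).congr_deriv ?_
    simp only [Pi.add_apply, Pi.mul_apply, Pi.pow_apply, id]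
    push_cast
    linear_combination (2 * (derivative p).eval x * exp (-2 * x)) * ode
  refine antitoneOn_of_deriv_nonpos (convex_Ici 0)
    (fun x _ => (hd x).continuousAt.continuousWithinAt)
    (fun x _ => (hd x).differentiableAt.differentiableWithinAt) fun x _ => ?_
  rw [(hd x).deriv]
  exact mul_nonpos_of_nonpos_of_nonneg (neg_nonpos.mpr (by positivity)) (exp_pos _).le

theorem abs_eval_laguerre_le (n : ℕ) {x : ℝ} (hx : 0 ≤ x) : |(laguerre n).eval x| ≤ exp x := by
  have h0 : (laguerre n).eval 0 = 1 := by
    rw [← Polynomial.coeff_zero_eq_eval_zero, coeff_laguerre]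
    simp
  rcases n.eq_zero_or_pos with rfl | hn
  · simpa [laguerre] using hx
  have h := antitoneOn_laguerre_energy n (Set.mem_Ici.mpr le_rfl) (Set.mem_Ici.mpr hx) hx
  simp only [h0, mul_zero, exp_zero, zero_mul, add_zero, one_pow, mul_one] at h
  have hn' : (0 : ℝ) < n := by exact_mod_cast hn
  have hexp : exp (-2 * x) * exp x ^ 2 = 1 := by
    rw [← exp_nat_mul, ← exp_add]
    simp
  refine abs_le_of_sq_le_sq (le_of_mul_le_mul_left ?_ hn') (exp_pos x).le
  calc (n : ℝ) * (laguerre n).eval x ^ 2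
      ≤ n * (laguerre n).eval x ^ 2 + x * (Polynomial.derivative (laguerre n)).eval x ^ 2 :=
        le_add_of_nonneg_right (by positivity)
    _ = (n * (laguerre n).eval x ^ 2 + x * (Polynomial.derivative (laguerre n)).eval x ^ 2)
          * exp (-2 * x) * exp x ^ 2 := by rw [mul_assoc _ (exp _), hexp, mul_one]
    _ ≤ n * exp x ^ 2 := by gcongr

theorem abs_lagFun_zero_le (n : ℕ) {x : ℝ} (hx : 0 ≤ x) : |lagFun 0 n x| ≤ exp x := by
  have hn : (n.factorial : ℝ) ≠ 0 := by positivity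
  rw [lagFun, add_zero, Real.Gamma_nat_eq_factorial, div_self hn, sqrt_one, zero_div, rpow_zero,
    one_mul, mul_one, genLagPoly_zero_eq_eval, abs_mul, abs_exp]
  calc exp (-x / 2) * |(laguerre n).eval x| ≤ 1 * exp x :=
        mul_le_mul (exp_le_one_iff.mpr (by linarith)) (abs_eval_laguerre_le n hx)
          (abs_nonneg _) zero_le_one
    _ = exp x := one_mul _

theorem abs_Uunif_le (l : ℕ) {x : ℝ} (hx : 0 ≤ x) : |Uunif l x| ≤ 2 * x * exp x := by
  have hint : ‖∫ z in Set.Ioo (0 : ℝ) x, lagFun 0 l z‖ ≤ exp x * volume.real (Set.Ioo 0 x) :=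
    norm_setIntegral_le_of_norm_le_const (by simp) fun z hz =>
      (abs_lagFun_zero_le l hz.1.le).trans (exp_le_exp.mpr hz.2.le)
  rw [Real.norm_eq_abs, Real.volume_real_Ioo_of_le hx] at hint
  have hφ : |x * lagFun 0 l x| ≤ x * exp x := by
    rw [abs_mul, abs_of_nonneg hx]
    exact mul_le_mul_of_nonneg_left (abs_lagFun_zero_le l hx) hx
  have := abs_add_le (∫ z in Set.Ioo (0 : ℝ) x, lagFun 0 l z) (x * lagFun 0 l x)
  rw [Uunif]
  linarith

/-- For any fixed `0 < a₀ < b₀ < ∞` there is a constant `c > 0` (depending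
only on `a₀` and `b₀`) such that `∫_{a₀}^{b₀} U_l² ≤ c` for every `l ≥ 0`. -/
theorem uniform_U_norm_bound (a₀ b₀ : ℝ) (ha₀ : 0 < a₀) (hab : a₀ < b₀) :
    ∃ c : ℝ, 0 < c ∧ ∀ l : ℕ, (∫ x in Set.Icc a₀ b₀, (Uunif l x) ^ 2) ≤ c := by
  have hb : 0 < b₀ := ha₀.trans hab
  refine ⟨(2 * b₀ * exp b₀) ^ 2 * (b₀ - a₀), mul_pos (by positivity) (sub_pos.mpr hab),
    fun l => ?_⟩
  have h : ‖∫ x in Set.Icc a₀ b₀, (Uunif l x) ^ 2‖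
      ≤ (2 * b₀ * exp b₀) ^ 2 * volume.real (Set.Icc a₀ b₀) := by
    refine norm_setIntegral_le_of_norm_le_const (by simp) fun x hx => ?_
    have hx0 : 0 ≤ x := ha₀.le.trans hx.1
    have hxb := hx.2
    rw [norm_pow, Real.norm_eq_abs]
    gcongr
    exact (abs_Uunif_le l hx0).trans (by gcongr)
  rw [Real.volume_real_Icc_of_le hab.le] at h
  exact (le_abs_self _).trans h
end

section
/- For the Pareto mixing distribution q(x|θ) = αθ^α x^{−α−1} 1(x ≥ θ) with shape parameter α > 2, let a = 0, write φ_l = φ_l^{(0)}, and define U_l(x) = −x^{α+1} ∫_x^∞ z^{−α−1} φ_l(z)dz + x φ_l(x). Then for every θ > 0 and every integer l ≥ 0, ∫_θ^∞ x^{−α−1} U_l(x)dx = θ ∫_θ^∞ x^{−α−1} φ_l(x)dx; equivalently, ∫_0^∞ q(x|θ)U_l(x)dx = θ ∫_0^∞ q(x|θ)φ_l(x)dx. -/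
open MeasureTheory Real

/-- `U_l` for the Pareto mixing distribution:
`U_l(x) = −x^{α+1}∫_x^∞ z^{−α−1}φ_l(z)dz + xφ_l(x)`, with `a = 0`. -/
noncomputable def Upareto (α : ℝ) (l : ℕ) (x : ℝ) : ℝ :=
  -(x ^ (α + 1)) * (∫ z in Set.Ioi x, z ^ (-(α + 1)) * lagFun 0 l z) + x * lagFun 0 l x

theorem abs_lagFun_zero_bounded (l : ℕ) : ∃ C : ℝ, ∀ x : ℝ, 0 < x → |lagFun 0 l x| ≤ C := by
  have hterm : ∀ (i : ℕ) (x : ℝ), 0 < x → exp (-x / 2) * x ^ i ≤ 2 ^ i * (i.factorial : ℝ) := by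
    intro i x hx
    have h := Real.pow_div_factorial_le_exp (x / 2) (by positivity) i
    rw [div_le_iff₀ (by positivity), div_pow, div_le_iff₀ (by positivity)] at h
    calc exp (-x / 2) * x ^ i ≤ exp (-x / 2) * (exp (x / 2) * i.factorial * 2 ^ i) := by gcongr
      _ = exp (-x / 2 + x / 2) * (2 ^ i * i.factorial) := by rw [exp_add]; ring
      _ = 2 ^ i * i.factorial := by rw [show -x / 2 + x / 2 = 0 by ring, exp_zero, one_mul]
  refine ⟨√((l.factorial : ℝ) / Gamma ((l : ℝ) + 0 + 1)) * ∑ i ∈ Finset.range (l + 1),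
    |(-1 : ℝ) ^ i * (Gamma ((l : ℝ) + 0 + 1) /
      (Gamma (0 + i + 1) * (Nat.factorial (l - i)))) / i.factorial| *
      (2 ^ i * (i.factorial : ℝ)), fun x hx => ?_⟩
  rw [lagFun, genLagPoly, zero_div, rpow_zero, mul_one, mul_assoc, abs_mul,
    abs_of_nonneg (sqrt_nonneg _), Finset.mul_sum]
  gcongr
  refine (Finset.abs_sum_le_sum_abs _ _).trans (Finset.sum_le_sum fun i _ => ?_)
  calc _ = |(-1 : ℝ) ^ i * (Gamma ((l : ℝ) + 0 + 1) /
      (Gamma (0 + i + 1) * (Nat.factorial (l - i)))) / i.factorial * (exp (-x / 2) * x ^ i)| := by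
        congr 1; ring
    _ ≤ _ := by
        rw [abs_mul, abs_of_nonneg (show 0 ≤ exp (-x / 2) * x ^ i by positivity)]
        exact mul_le_mul_of_nonneg_left (hterm i x hx) (abs_nonneg _)

theorem continuous_lagFun_zero (l : ℕ) : Continuous (lagFun 0 l) := by
  unfold lagFun genLagPoly
  simp only [zero_div, rpow_zero]
  fun_prop

section Tail

variable {g : ℝ → ℝ} {α C : ℝ}

theorem integrableOn_Ioi_of_abs_le_rpow (hα : 0 < α) (hg : ContinuousOn g (Set.Ioi 0))
    (hC : ∀ x, 0 < x → |g x| ≤ C * x ^ (-(α + 1))) {a : ℝ} (ha : 0 < a) :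
    IntegrableOn g (Set.Ioi a) := by
  refine Integrable.mono' ((integrableOn_Ioi_rpow_of_lt (a := -(α + 1)) (by linarith) ha).const_mul C)
    ((hg.mono (Set.Ioi_subset_Ioi ha.le)).aestronglyMeasurable measurableSet_Ioi) ?_
  filter_upwards [ae_restrict_mem measurableSet_Ioi] with x hx
  exact hC x (ha.trans hx)

theorem abs_integral_Ioi_le_rpow (hα : 0 < α)
    (hC : ∀ x, 0 < x → |g x| ≤ C * x ^ (-(α + 1))) {a : ℝ} (ha : 0 < a) :
    |∫ z in Set.Ioi a, g z| ≤ C / α * a ^ (-α) := by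
  have hint := (integrableOn_Ioi_rpow_of_lt (a := -(α + 1)) (by linarith) ha).const_mul C
  have h := norm_integral_le_of_norm_le (f := g) hint (by
    filter_upwards [ae_restrict_mem measurableSet_Ioi] with x hx
    exact hC x (ha.trans hx))
  rw [integral_const_mul, integral_Ioi_rpow_of_lt (by linarith) ha,
    show -(α + 1) + 1 = -α by ring, neg_div_neg_eq] at h
  calc _ ≤ _ := h
    _ = _ := by ring

theorem hasDerivAt_integral_Ioi (hg : ContinuousOn g (Set.Ioi 0))
    (hint : ∀ a : ℝ, 0 < a → IntegrableOn g (Set.Ioi a)) {x : ℝ} (hx : 0 < x) :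
    HasDerivAt (fun y => ∫ z in Set.Ioi y, g z) (-g x) x := by
  have hev : (fun y => ∫ z in Set.Ioi y, g z) =ᶠ[nhds x]
      fun y => (∫ z in Set.Ioi (x / 2), g z) - ∫ z in (x / 2)..y, g z := by
    filter_upwards [lt_mem_nhds hx] with y hy
    rw [← intervalIntegral.integral_Ioi_sub_Ioi' (hint _ (half_pos hx)) (hint _ hy)]
    ring
  refine HasDerivAt.congr_of_eventuallyEq ?_ hev
  refine (intervalIntegral.integral_hasDerivAt_right ?_ ?_ ?_).const_sub _
  · exact (intervalIntegrable_iff_integrableOn_Ioc_of_le (half_le_self hx.le)).2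
      ((hint _ (half_pos hx)).mono_set Set.Ioc_subset_Ioi_self)
  · exact hg.stronglyMeasurableAtFilter isOpen_Ioi x hx
  · exact hg.continuousAt (Ioi_mem_nhds hx)

theorem integral_Ioi_mul_sub_tail (hα : 1 < α) (hg : ContinuousOn g (Set.Ioi 0))
    (hC : ∀ x, 0 < x → |g x| ≤ C * x ^ (-(α + 1))) {θ : ℝ} (hθ : 0 < θ) :
    ∫ x in Set.Ioi θ, (x * g x - ∫ z in Set.Ioi x, g z) = θ * ∫ x in Set.Ioi θ, g x := by
  have hα0 : 0 < α := by linarith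
  have hint : ∀ a : ℝ, 0 < a → IntegrableOn g (Set.Ioi a) := fun a ha =>
    integrableOn_Ioi_of_abs_le_rpow hα0 hg hC ha
  have hderiv : ∀ x : ℝ, 0 < x → HasDerivAt (fun y => ∫ z in Set.Ioi y, g z) (-g x) x :=
    fun x hx => hasDerivAt_integral_Ioi hg hint hx
  have hprod : ∀ x ∈ Set.Ici θ, HasDerivAt (fun y => -(y * ∫ z in Set.Ioi y, g z))
      (x * g x - ∫ z in Set.Ioi x, g z) x := by
    intro x hx
    refine ((hasDerivAt_id' x).mul (hderiv x (hθ.trans_le hx))).neg.congr_deriv ?_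
    ring
  have htail : ContinuousOn (fun y => ∫ z in Set.Ioi y, g z) (Set.Ioi 0) := fun x hx =>
    (hderiv x hx).continuousAt.continuousWithinAt
  have hmulrpow : ∀ x : ℝ, 0 < x → x * x ^ (-(α + 1)) = x ^ (-α) := fun x hx => by
    rw [← rpow_one_add' hx.le (by linarith)]
    ring_nf
  have hderint : IntegrableOn (fun x => x * g x - ∫ z in Set.Ioi x, g z) (Set.Ioi θ) := by
    refine Integrable.mono' ((integrableOn_Ioi_rpow_of_lt (a := -α) (by linarith) hθ).const_mul
      (C + C / α)) ((((continuousOn_id.mul hg).sub htail).mono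
        (Set.Ioi_subset_Ioi hθ.le)).aestronglyMeasurable measurableSet_Ioi) ?_
    filter_upwards [ae_restrict_mem measurableSet_Ioi] with x hx
    have hx0 : 0 < x := hθ.trans hx
    calc |x * g x - ∫ z in Set.Ioi x, g z| ≤ |x * g x| + |∫ z in Set.Ioi x, g z| := abs_sub _ _
      _ ≤ x * (C * x ^ (-(α + 1))) + C / α * x ^ (-α) := by
          rw [abs_mul, abs_of_pos hx0]
          gcongr
          · exact hC x hx0
          · exact abs_integral_Ioi_le_rpow hα0 hC hx0
      _ = (C + C / α) * x ^ (-α) := by rw [← hmulrpow x hx0]; ring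
  have hlim : Filter.Tendsto (fun y => -(y * ∫ z in Set.Ioi y, g z)) Filter.atTop (nhds 0) := by
    have h0 : Filter.Tendsto (fun x : ℝ => C / α * x ^ (-(α - 1))) Filter.atTop (nhds 0) := by
      simpa using (tendsto_rpow_neg_atTop (sub_pos.2 hα)).const_mul (C / α)
    refine squeeze_zero_norm' ?_ h0
    filter_upwards [Filter.eventually_gt_atTop 0] with x hx
    rw [norm_neg, norm_mul, norm_of_nonneg hx.le]
    calc x * |∫ z in Set.Ioi x, g z| ≤ x * (C / α * x ^ (-α)) := by
          gcongr
          exact abs_integral_Ioi_le_rpow hα0 hC hx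
      _ = C / α * (x * x ^ (-α)) := by ring
      _ = C / α * x ^ (-(α - 1)) := by
          rw [← rpow_one_add' hx.le (by linarith)]
          ring_nf
  rw [integral_Ioi_of_hasDerivAt_of_tendsto' hprod hderint hlim]
  ring

end Tail

theorem integral_Ioi_zero_ite_rpow_mul (c p : ℝ) {θ : ℝ} (hθ : 0 < θ) (f : ℝ → ℝ) :
    ∫ x in Set.Ioi (0 : ℝ), (if θ ≤ x then c * x ^ p else 0) * f x =
      c * ∫ x in Set.Ioi θ, x ^ p * f x := by
  have h : (fun x => (if θ ≤ x then c * x ^ p else 0) * f x) =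
      (Set.Ici θ).indicator fun x => c * (x ^ p * f x) := by
    ext x
    by_cases hx : θ ≤ x <;> simp [hx, mul_assoc]
  rw [h, setIntegral_indicator measurableSet_Ici,
    Set.inter_eq_right.2 (Set.Ici_subset_Ioi.2 hθ), integral_Ici_eq_integral_Ioi,
    integral_const_mul]

/-- For the Pareto mixing distribution `q(x|θ) = αθ^α x^{−α−1} 1(x ≥ θ)`
with `α > 2`, for every `θ > 0` and `l ≥ 0`,
`∫_θ^∞ x^{−α−1}U_l(x)dx = θ∫_θ^∞ x^{−α−1}φ_l(x)dx`; equivalently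
`∫_0^∞ q(x|θ)U_l(x)dx = θ∫_0^∞ q(x|θ)φ_l(x)dx`. -/
theorem pareto_U_identity (α : ℝ) (hα : 2 < α) (θ : ℝ) (hθ : 0 < θ) (l : ℕ) :
    ((∫ x in Set.Ioi θ, x ^ (-(α + 1)) * Upareto α l x) =
        θ * ∫ x in Set.Ioi θ, x ^ (-(α + 1)) * lagFun 0 l x) ∧
      ((∫ x in Set.Ioi (0 : ℝ),
          (if θ ≤ x then α * θ ^ α * x ^ (-(α + 1)) else 0) * Upareto α l x) =
        θ * ∫ x in Set.Ioi (0 : ℝ),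
          (if θ ≤ x then α * θ ^ α * x ^ (-(α + 1)) else 0) * lagFun 0 l x) := by
  obtain ⟨C, hC⟩ := abs_lagFun_zero_bounded l
  have key : (∫ x in Set.Ioi θ, x ^ (-(α + 1)) * Upareto α l x) =
      θ * ∫ x in Set.Ioi θ, x ^ (-(α + 1)) * lagFun 0 l x := by
    rw [← integral_Ioi_mul_sub_tail (g := fun x => x ^ (-(α + 1)) * lagFun 0 l x) (α := α) (C := C)
      (by linarith) ?_ ?_ hθ]
    · refine setIntegral_congr_fun measurableSet_Ioi fun x hx => ?_
      have hx0 : 0 < x := hθ.trans hx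
      have hinv : x ^ (-(α + 1)) * x ^ (α + 1) = 1 := by
        rw [← rpow_add hx0, neg_add_cancel, rpow_zero]
      simp only [Upareto]
      linear_combination (-∫ z in Set.Ioi x, z ^ (-(α + 1)) * lagFun 0 l z) * hinv
    · exact ContinuousOn.mul (fun x hx =>
        (continuousAt_rpow_const x _ (Or.inl (ne_of_gt hx))).continuousWithinAt)
        (continuous_lagFun_zero l).continuousOn
    · intro x hx
      rw [abs_mul, abs_of_nonneg (rpow_nonneg hx.le _), mul_comm]
      gcongr
      exact hC x hx
  refine ⟨key, ?_⟩
  rw [integral_Ioi_zero_ite_rpow_mul _ _ hθ, integral_Ioi_zero_ite_rpow_mul _ _ hθ, key]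
  ring
end

section
/- For the beta mixing distribution q(x|θ) = [Γ(θ+α)/(Γ(θ)Γ(α))] x^{α−1}(1−x)^{θ−1} on (0,1) with known α > 0 and unknown θ > 0, let a = 2 and define U_l(x) = (α−1)(1−x)x^{−1} φ_l^{(2)}(x) + (1−x)(φ_l^{(2)})'(x). Then for every θ > 0 and every integer l ≥ 0, ∫_0^1 x^{α−1}(1−x)^{θ−1} U_l(x)dx = θ ∫_0^1 x^{α−1}(1−x)^{θ−1} φ_l^{(2)}(x)dx. -/
open MeasureTheory Real

/-- `U_l` for the beta mixing distribution:
`U_l(x) = (α−1)(1−x)x⁻¹φ_l^{(2)}(x) + (1−x)(φ_l^{(2)})′(x)`, with `a = 2`. -/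
noncomputable def Ubeta (α : ℝ) (l : ℕ) (x : ℝ) : ℝ :=
  (α - 1) * (1 - x) * x⁻¹ * lagFun 2 l x + (1 - x) * deriv (lagFun 2 l) x

/-- The beta weight `x^{α−1}(1−x)^{θ−1}` is integrable on `(0,1)` for `α, θ > 0`. -/
theorem integrableOn_beta_weight {α θ : ℝ} (hα : 0 < α) (hθ : 0 < θ) :
    IntegrableOn (fun x : ℝ => x ^ (α - 1) * (1 - x) ^ (θ - 1)) (Set.Ioo 0 1) := by
  have h := Complex.betaIntegral_convergent (u := (α : ℂ)) (v := (θ : ℂ)) (by simpa) (by simpa)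
  rw [intervalIntegrable_iff_integrableOn_Ioo_of_le zero_le_one] at h
  refine IntegrableOn.congr_fun (f := fun x : ℝ => RCLike.re
    ((x : ℂ) ^ ((α : ℂ) - 1) * (1 - (x : ℂ)) ^ ((θ : ℂ) - 1))) (Integrable.re h) ?_
    measurableSet_Ioo
  intro x hx
  have h1 : (x : ℂ) ^ ((α : ℂ) - 1) = ((x ^ (α - 1) : ℝ) : ℂ) := by
    rw [Complex.ofReal_cpow hx.1.le]
    push_cast
    rfl
  have h2 : (1 - (x : ℂ)) ^ ((θ : ℂ) - 1) = (((1 - x) ^ (θ - 1) : ℝ) : ℂ) := by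
    rw [Complex.ofReal_cpow (sub_nonneg.2 hx.2.le)]
    push_cast
    rfl
  simp only [h1, h2, ← Complex.ofReal_mul]
  exact Complex.ofReal_re _

/-- The beta weight times a function continuous on `ℝ` is integrable on `(0,1)`. -/
theorem integrableOn_beta_weight_mul {α θ : ℝ} (hα : 0 < α) (hθ : 0 < θ) {h : ℝ → ℝ}
    (hh : Continuous h) :
    IntegrableOn (fun x : ℝ => x ^ (α - 1) * (1 - x) ^ (θ - 1) * h x) (Set.Ioo 0 1) :=
  (integrableOn_beta_weight hα hθ).mul_continuousOn_of_subset hh.continuousOn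
    measurableSet_Ioo isCompact_Icc Set.Ioo_subset_Icc_self

/-- Integration by parts against the beta weight. -/
theorem integral_beta_weight_by_parts {α θ : ℝ} (hα : 0 < α) (hθ : 0 < θ) {g g' : ℝ → ℝ}
    (hg : ∀ x, HasDerivAt g (g' x) x) (hg' : Continuous g') :
    (∫ x in Set.Ioo (0 : ℝ) 1,
      x ^ (α - 1) * (1 - x) ^ (θ - 1) * ((1 - x) * (α * g x + x * g' x))) =
      θ * ∫ x in Set.Ioo (0 : ℝ) 1, x ^ (α - 1) * (1 - x) ^ (θ - 1) * (x * g x) := by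
  have hgc : Continuous g := continuous_iff_continuousAt.2 fun x => (hg x).continuousAt
  have i1 := integrableOn_beta_weight_mul hα hθ (h := fun x => (1 - x) * (α * g x + x * g' x))
    (by fun_prop)
  have i2 := (integrableOn_beta_weight_mul hα hθ (h := fun x => x * g x)
    (by fun_prop)).const_mul θ
  have hF : ContinuousOn (fun x : ℝ => x ^ α * (1 - x) ^ θ * g x) (Set.Icc 0 1) := by
    refine Continuous.continuousOn ?_
    exact ((Real.continuous_rpow_const hα.le).mul
      ((Real.continuous_rpow_const hθ.le).comp (continuous_const.sub continuous_id))).mul hgc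
  have hderiv : ∀ x ∈ Set.Ioo (0 : ℝ) 1, HasDerivAt (fun x : ℝ => x ^ α * (1 - x) ^ θ * g x)
      (x ^ (α - 1) * (1 - x) ^ (θ - 1) * ((1 - x) * (α * g x + x * g' x)) -
        θ * (x ^ (α - 1) * (1 - x) ^ (θ - 1) * (x * g x))) x := by
    intro x hx
    have hx1 : 0 < 1 - x := sub_pos.2 hx.2
    have d1 := Real.hasDerivAt_rpow_const (x := x) (p := α) (Or.inl hx.1.ne')
    have d2 := ((hasDerivAt_id x).const_sub 1).rpow_const (p := θ) (Or.inl hx1.ne')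
    refine ((d1.mul d2).mul (hg x)).congr_deriv ?_
    have e1 : x ^ α = x ^ (α - 1) * x := by
      rw [← Real.rpow_add_one hx.1.ne', sub_add_cancel]
    have e2 : (1 - x) ^ θ = (1 - x) ^ (θ - 1) * (1 - x) := by
      rw [← Real.rpow_add_one hx1.ne', sub_add_cancel]
    simp only [id, Pi.mul_apply, e1, e2]
    ring
  have key := intervalIntegral.integral_eq_sub_of_hasDerivAt_of_le zero_le_one hF hderiv
    ((intervalIntegrable_iff_integrableOn_Ioo_of_le zero_le_one).2 (i1.sub i2))
  rw [intervalIntegral.integral_of_le zero_le_one, integral_Ioc_eq_integral_Ioo,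
    integral_sub i1 i2, integral_const_mul] at key
  simp only [sub_self, Real.zero_rpow hα.ne', Real.zero_rpow hθ.ne', mul_zero, zero_mul] at key
  exact sub_eq_zero.1 key

theorem contDiff_genLagPoly (a : ℝ) (k : ℕ) : ContDiff ℝ 1 (genLagPoly a k) := by
  unfold genLagPoly
  fun_prop

/-- `φ_l^{(2)}(x)` is `x` times a continuously differentiable function. -/
theorem exists_contDiff_lagFun_two (l : ℕ) :
    ∃ g : ℝ → ℝ, ContDiff ℝ 1 g ∧ lagFun 2 l = fun x => x * g x := by
  refine ⟨fun x => Real.sqrt ((Nat.factorial l : ℝ) / Real.Gamma ((l : ℝ) + 2 + 1)) *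
    Real.exp (-x / 2) * genLagPoly 2 l x, ?_, ?_⟩
  · have := contDiff_genLagPoly 2 l
    fun_prop
  · funext x
    simp only [lagFun, div_self (two_ne_zero : (2 : ℝ) ≠ 0), Real.rpow_one]
    ring

/-- For the beta mixing distribution
`q(x|θ) = [Γ(θ+α)/(Γ(θ)Γ(α))]x^{α−1}(1−x)^{θ−1}` on `(0,1)` with `α > 0`, for every
`θ > 0` and `l ≥ 0`,
`∫_0^1 x^{α−1}(1−x)^{θ−1}U_l(x)dx = θ∫_0^1 x^{α−1}(1−x)^{θ−1}φ_l^{(2)}(x)dx`. -/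
theorem beta_U_identity (α : ℝ) (hα : 0 < α) (θ : ℝ) (hθ : 0 < θ) (l : ℕ) :
    (∫ x in Set.Ioo (0 : ℝ) 1, x ^ (α - 1) * (1 - x) ^ (θ - 1) * Ubeta α l x) =
      θ * ∫ x in Set.Ioo (0 : ℝ) 1, x ^ (α - 1) * (1 - x) ^ (θ - 1) * lagFun 2 l x := by
  obtain ⟨g, hg, hφ⟩ := exists_contDiff_lagFun_two l
  have hd : ∀ x, HasDerivAt g (deriv g x) x := fun x =>
    (hg.differentiable one_ne_zero x).hasDerivAt
  have hU : ∀ x ∈ Set.Ioo (0 : ℝ) 1, x ^ (α - 1) * (1 - x) ^ (θ - 1) * Ubeta α l x =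
      x ^ (α - 1) * (1 - x) ^ (θ - 1) * ((1 - x) * (α * g x + x * deriv g x)) := by
    intro x hx
    have hx0 : x ≠ 0 := hx.1.ne'
    have hdφ : deriv (fun x => x * g x) x = 1 * g x + x * deriv g x :=
      ((hasDerivAt_id' x).mul (hd x)).deriv
    rw [Ubeta, hφ, hdφ]
    field_simp
    ring
  rw [setIntegral_congr_fun measurableSet_Ioo hU, hφ]
  exact integral_beta_weight_by_parts hα hθ hd hg.continuous_deriv_one
end

section
/- For the beta mixing setup with a = 2 and U_l(x) = (α−1)(1−x)x^{−1} φ_l^{(2)}(x) + (1−x)(φ_l^{(2)})'(x), there exists a constant c > 0 (depending only on α) such that for every integer l ≥ 0, ∫_0^1 U_l^2(x)dx ≤ c (l ∨ 1). -/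
open MeasureTheory Real

/-- The generalized Laguerre polynomial `L_n^{(a)}(x)` for a natural parameter `a`. -/
noncomputable def natLag (a n : ℕ) (x : ℝ) : ℝ :=
  ∑ i ∈ Finset.range (n + 1), (-1 : ℝ) ^ i * ((n + a).choose (i + a) : ℝ) * x ^ i / (i.factorial : ℝ)

theorem natLag_eq_sum_range {a n N : ℕ} (h : n + 1 ≤ N) (x : ℝ) :
    natLag a n x = ∑ i ∈ Finset.range N,
      (-1 : ℝ) ^ i * ((n + a).choose (i + a) : ℝ) * x ^ i / (i.factorial : ℝ) := by
  unfold natLag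
  refine Finset.sum_subset (Finset.range_mono h) fun i _ hi => ?_
  rw [Finset.mem_range, not_lt] at hi
  rw [Nat.choose_eq_zero_of_lt (by omega)]
  simp

theorem genLagPoly_two_eq_natLag (n : ℕ) (x : ℝ) : genLagPoly 2 n x = natLag 2 n x := by
  unfold genLagPoly natLag
  refine Finset.sum_congr rfl fun i hi => ?_
  have hi' : i ≤ n := by rw [Finset.mem_range] at hi; omega
  have h1 : Real.Gamma ((n : ℝ) + 2 + 1) = ((n + 2).factorial : ℝ) := by
    rw [← Real.Gamma_nat_eq_factorial]; push_cast; ring_nf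
  have h2 : Real.Gamma ((2 : ℝ) + i + 1) = ((i + 2).factorial : ℝ) := by
    rw [← Real.Gamma_nat_eq_factorial]; push_cast; ring_nf
  rw [h1, h2, Nat.cast_choose ℝ (show i + 2 ≤ n + 2 by omega),
    show n + 2 - (i + 2) = n - i by omega]

theorem natLag_succ_succ (a n : ℕ) (x : ℝ) :
    natLag (a + 1) (n + 1) x = natLag (a + 1) n x + natLag a (n + 1) x := by
  rw [natLag_eq_sum_range (a := a + 1) (n := n) (N := n + 2) (by omega)]
  unfold natLag
  rw [← Finset.sum_add_distrib]
  refine Finset.sum_congr rfl fun i _ => ?_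
  rw [show n + 1 + (a + 1) = (n + a + 1) + 1 by ring, show i + (a + 1) = (i + a) + 1 by ring,
    Nat.choose_succ_succ, show n + (a + 1) = n + a + 1 by ring,
    show n + 1 + a = n + a + 1 by ring]
  push_cast
  ring

theorem natLag_zero_right (a : ℕ) (x : ℝ) : natLag a 0 x = 1 := by simp [natLag]

theorem natLag_zero_eval_zero (n : ℕ) : natLag 0 n 0 = 1 := by
  unfold natLag
  rw [Finset.sum_range_succ']
  simp

theorem hasDerivAt_natLag_succ (a n : ℕ) (x : ℝ) :
    HasDerivAt (natLag a (n + 1)) (-natLag (a + 1) n x) x := by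
  have h : HasDerivAt (fun y : ℝ => ∑ i ∈ Finset.range (n + 2),
      (-1 : ℝ) ^ i * ((n + 1 + a).choose (i + a) : ℝ) * y ^ i / (i.factorial : ℝ))
      (∑ i ∈ Finset.range (n + 2), (-1 : ℝ) ^ i * ((n + 1 + a).choose (i + a) : ℝ) *
        (i * x ^ (i - 1)) / (i.factorial : ℝ)) x :=
    HasDerivAt.fun_sum fun i _ => ((hasDerivAt_pow i x).const_mul _).div_const _
  refine h.congr_deriv ?_
  rw [Finset.sum_range_succ']
  unfold natLag
  rw [← Finset.sum_neg_distrib]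
  simp only [Nat.cast_zero, zero_mul, mul_zero, zero_div, add_zero]
  refine Finset.sum_congr rfl fun i _ => ?_
  rw [show n + (a + 1) = n + 1 + a by ring, show i + (a + 1) = i + 1 + a by ring,
    Nat.factorial_succ, Nat.add_sub_cancel]
  have := Nat.factorial_ne_zero i
  push_cast
  field_simp
  ring

theorem continuous_natLag (a n : ℕ) : Continuous (natLag a n) := by
  unfold natLag
  fun_prop

theorem differentiable_natLag (a n : ℕ) : Differentiable ℝ (natLag a n) := by
  unfold natLag
  fun_prop

/-- The raising relation `x (L_n^{(2)})' + 2 L_n^{(2)} = (n + 2) L_n^{(1)}`. -/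
theorem mul_deriv_natLag_two (n : ℕ) (x : ℝ) :
    x * deriv (natLag 2 n) x + 2 * natLag 2 n x = (n + 2) * natLag 1 n x := by
  have h : HasDerivAt (natLag 2 n)
      (∑ i ∈ Finset.range (n + 1), (-1 : ℝ) ^ i * ((n + 2).choose (i + 2) : ℝ) *
        (i * x ^ (i - 1)) / (i.factorial : ℝ)) x :=
    HasDerivAt.fun_sum fun i _ => ((hasDerivAt_pow i x).const_mul _).div_const _
  rw [h.deriv]
  unfold natLag
  rw [Finset.mul_sum, Finset.mul_sum, Finset.mul_sum, ← Finset.sum_add_distrib]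
  refine Finset.sum_congr rfl fun i _ => ?_
  have hc : ((n : ℝ) + 2) * ((n + 1).choose (i + 1) : ℝ) =
      ((n + 2).choose (i + 2) : ℝ) * (i + 2) := by
    exact_mod_cast Nat.add_one_mul_choose_eq (n + 1) (i + 1)
  have hx : x * ((i : ℝ) * x ^ (i - 1)) = i * x ^ i := by
    rcases i with _ | i
    · simp
    · rw [Nat.add_sub_cancel]; ring
  linear_combination ((-1 : ℝ) ^ i * ((n + 2).choose (i + 2) : ℝ) / (i.factorial : ℝ)) * hx
    - ((-1 : ℝ) ^ i * x ^ i / (i.factorial : ℝ)) * hc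

theorem mul_natLag_two (n : ℕ) (x : ℝ) :
    x * natLag 2 n x = (n + 2) * natLag 1 n x - (n + 1) * natLag 1 (n + 1) x := by
  rw [natLag_eq_sum_range (a := 1) (n := n) (N := n + 2) (by omega)]
  unfold natLag
  rw [Finset.mul_sum, Finset.mul_sum, Finset.mul_sum, ← Finset.sum_sub_distrib,
    Finset.sum_range_succ' _ (n + 1)]
  have h0 : ((n : ℝ) + 2) * ((-1 : ℝ) ^ 0 * ((n + 1).choose (0 + 1) : ℝ) * x ^ 0 /
        (Nat.factorial 0 : ℝ)) - (n + 1) * ((-1 : ℝ) ^ 0 * ((n + 1 + 1).choose (0 + 1) : ℝ) * x ^ 0 /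
        (Nat.factorial 0 : ℝ)) = 0 := by
    simp only [zero_add, Nat.choose_one_right, Nat.factorial_zero]
    push_cast
    ring
  rw [h0, add_zero]
  refine Finset.sum_congr rfl fun i _ => ?_
  have hc : ((n : ℝ) + 2) * ((n + 1).choose (i + 1) : ℝ) =
      ((n + 2).choose (i + 2) : ℝ) * (i + 2) := by
    exact_mod_cast Nat.add_one_mul_choose_eq (n + 1) (i + 1)
  have hp : ((n + 2).choose (i + 2) : ℝ) =
      ((n + 1).choose (i + 1) : ℝ) + ((n + 1).choose (i + 2) : ℝ) := by
    exact_mod_cast Nat.choose_succ_succ (n + 1) (i + 1)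
  rw [show i + 1 + 1 = i + 2 by ring, show n + 1 + 1 = n + 2 by ring, Nat.factorial_succ]
  have := Nat.factorial_ne_zero i
  push_cast
  field_simp
  rw [pow_succ, pow_succ]
  have key : ((n : ℝ) + 2) * ((n + 1).choose (i + 2) : ℝ) =
      (n - i) * ((n + 2).choose (i + 2) : ℝ) := by
    linear_combination -hc - ((n : ℝ) + 2) * hp
  linear_combination ((-1 : ℝ) ^ i * x ^ i * x) * key

/-- The partial sums `L_n^{(1)} = ∑_{i ≤ n} L_i^{(0)}` have weighted square norm at most `n + 1`,
already by one integration by parts. -/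
theorem integral_exp_neg_mul_natLag_one_sq_le (n : ℕ) :
    ∫ x in (0 : ℝ)..1, Real.exp (-x) * natLag 1 n x ^ 2 ≤ n + 1 := by
  induction n with
  | zero =>
    simp only [natLag_zero_right, one_pow, mul_one, intervalIntegral.integral_comp_neg fun x => Real.exp x,
      integral_exp]
    have := Real.exp_pos (-1)
    norm_num
    linarith
  | succ n ih =>
    have hQ := continuous_natLag 1 n
    have hR := continuous_natLag 0 (n + 1)
    have hF : ∀ x : ℝ, HasDerivAt (fun y => -(Real.exp (-y) * natLag 0 (n + 1) y ^ 2))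
        (Real.exp (-x) * (natLag 0 (n + 1) x ^ 2 + 2 * natLag 0 (n + 1) x * natLag 1 n x)) x := by
      intro x
      refine (((hasDerivAt_neg x).exp).mul
        ((hasDerivAt_natLag_succ 0 n x).pow 2)).neg.congr_deriv ?_
      simp only [Nat.cast_ofNat, Pi.pow_apply, zero_add]
      ring
    have hI := intervalIntegral.integral_eq_sub_of_hasDerivAt (a := 0) (b := 1)
      (fun x _ => hF x) (Continuous.intervalIntegrable (by fun_prop) _ _)
    have hs : ∫ x in (0 : ℝ)..1, Real.exp (-x) * natLag 1 (n + 1) x ^ 2 =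
        (∫ x in (0 : ℝ)..1, Real.exp (-x) * natLag 1 n x ^ 2) + ∫ x in (0 : ℝ)..1,
          Real.exp (-x) * (natLag 0 (n + 1) x ^ 2 + 2 * natLag 0 (n + 1) x * natLag 1 n x) := by
      rw [← intervalIntegral.integral_add (Continuous.intervalIntegrable (by fun_prop) _ _)
        (Continuous.intervalIntegrable (by fun_prop) _ _)]
      refine intervalIntegral.integral_congr fun x _ => ?_
      simp only [natLag_succ_succ 0 n x, zero_add]
      ring
    rw [hs, hI, natLag_zero_eval_zero]
    have : 0 ≤ Real.exp (-1) * natLag 0 (n + 1) 1 ^ 2 := by positivity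
    simp only [neg_zero, Real.exp_zero]
    push_cast
    linarith

theorem natLag_two_eq_sum (n : ℕ) (x : ℝ) :
    natLag 2 n x = ∑ i ∈ Finset.range (n + 1), natLag 1 i x := by
  induction n with
  | zero => simp [natLag_zero_right]
  | succ n ih => rw [Finset.sum_range_succ, ← ih, natLag_succ_succ]

theorem integral_exp_neg_mul_natLag_two_sq_le (n : ℕ) :
    ∫ x in (0 : ℝ)..1, Real.exp (-x) * natLag 2 n x ^ 2 ≤ (n + 1) ^ 2 * (n + 2) / 2 := by
  have hP := continuous_natLag 2 n
  have hcont : ∀ i : ℕ, Continuous fun x => Real.exp (-x) * natLag 1 i x ^ 2 := fun i => by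
    have := continuous_natLag 1 i
    fun_prop
  have hgauss : ∀ m : ℕ, ∑ i ∈ Finset.range (m + 1), ((i : ℝ) + 1) = (m + 1) * (m + 2) / 2 := by
    intro m
    induction m with
    | zero => norm_num
    | succ m ih => rw [Finset.sum_range_succ, ih]; push_cast; ring
  calc ∫ x in (0 : ℝ)..1, Real.exp (-x) * natLag 2 n x ^ 2
      ≤ ∫ x in (0 : ℝ)..1,
          ((n : ℝ) + 1) * ∑ i ∈ Finset.range (n + 1), Real.exp (-x) * natLag 1 i x ^ 2 := by
        refine intervalIntegral.integral_mono_on zero_le_one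
          (Continuous.intervalIntegrable (by fun_prop) _ _)
          ((continuous_const.mul (continuous_finsetSum _ fun i _ => hcont i)).intervalIntegrable
            _ _) fun x _ => ?_
        have h := sq_sum_le_card_mul_sum_sq (s := Finset.range (n + 1))
          (f := fun i => natLag 1 i x)
        rw [← natLag_two_eq_sum, Finset.card_range] at h
        push_cast at h
        rw [← Finset.mul_sum, mul_left_comm]
        exact mul_le_mul_of_nonneg_left h (Real.exp_pos _).le
    _ = (n + 1) * ∑ i ∈ Finset.range (n + 1),
          ∫ x in (0 : ℝ)..1, Real.exp (-x) * natLag 1 i x ^ 2 := by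
        rw [intervalIntegral.integral_const_mul,
          intervalIntegral.integral_finsetSum fun i _ => (hcont i).intervalIntegrable _ _]
    _ ≤ (n + 1) * ∑ i ∈ Finset.range (n + 1), ((i : ℝ) + 1) := by
        gcongr with i _
        exact integral_exp_neg_mul_natLag_one_sq_le i
    _ = (n + 1) ^ 2 * (n + 2) / 2 := by
        rw [hgauss]; ring

theorem lagFun_two (n : ℕ) : lagFun 2 n = fun x =>
    Real.sqrt (1 / (((n : ℝ) + 1) * (n + 2))) * (Real.exp (-x / 2) * x * natLag 2 n x) := by
  funext x
  have h1 : Real.Gamma ((n : ℝ) + 2 + 1) = ((n + 2).factorial : ℝ) := by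
    rw [← Real.Gamma_nat_eq_factorial]; push_cast; ring_nf
  have h2 : (n.factorial : ℝ) / ((n + 2).factorial : ℝ) = 1 / (((n : ℝ) + 1) * (n + 2)) := by
    have := Nat.factorial_ne_zero n
    rw [Nat.factorial_succ, Nat.factorial_succ]
    push_cast
    field_simp
    ring
  rw [lagFun, genLagPoly_two_eq_natLag, h1, h2, div_self two_ne_zero, Real.rpow_one]
  ring

theorem Ubeta_eq (α : ℝ) (n : ℕ) {x : ℝ} (hx : x ≠ 0) :
    Ubeta α n x = Real.sqrt (1 / (((n : ℝ) + 1) * (n + 2))) * (1 - x) * Real.exp (-x / 2) *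
      ((α - 2) * natLag 2 n x + (n + 1) / 2 * natLag 1 (n + 1) x
        + (n + 2) / 2 * natLag 1 n x) := by
  have he : HasDerivAt (fun y : ℝ => Real.exp (-y / 2)) (Real.exp (-x / 2) * (-1 / 2)) x :=
    ((hasDerivAt_neg x).div_const 2).exp
  have hd : HasDerivAt (lagFun 2 n) (Real.sqrt (1 / (((n : ℝ) + 1) * (n + 2))) *
      ((Real.exp (-x / 2) * (-1 / 2) * x + Real.exp (-x / 2) * 1) * natLag 2 n x +
        Real.exp (-x / 2) * x * deriv (natLag 2 n) x)) x := by
    rw [lagFun_two]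
    exact ((he.mul (hasDerivAt_id x)).mul (differentiable_natLag 2 n x).hasDerivAt).const_mul _
  rw [Ubeta, hd.deriv, lagFun_two]
  have e1 := mul_deriv_natLag_two n x
  have e2 := mul_natLag_two n x
  have e3 : x⁻¹ * x = 1 := inv_mul_cancel₀ hx
  linear_combination (Real.sqrt (1 / (((n : ℝ) + 1) * (n + 2))) * (1 - x) * Real.exp (-x / 2)) *
    ((α - 1) * natLag 2 n x * e3 + e1 - e2 / 2)

theorem Ubeta_sq_le (α : ℝ) (n : ℕ) {x : ℝ} (hx : 0 < x) (hx1 : x < 1) :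
    Ubeta α n x ^ 2 ≤ 3 / (((n : ℝ) + 1) * (n + 2)) *
      ((α - 2) ^ 2 * (Real.exp (-x) * natLag 2 n x ^ 2)
        + ((n + 1) / 2) ^ 2 * (Real.exp (-x) * natLag 1 (n + 1) x ^ 2)
        + ((n + 2) / 2) ^ 2 * (Real.exp (-x) * natLag 1 n x ^ 2)) := by
  have hexp : Real.exp (-x / 2) ^ 2 = Real.exp (-x) := by
    rw [← Real.exp_nat_mul]; congr 1; push_cast; ring
  have h3 : ∀ u v w : ℝ, (u + v + w) ^ 2 ≤ 3 * (u ^ 2 + v ^ 2 + w ^ 2) := fun u v w => by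
    nlinarith [sq_nonneg (u - v), sq_nonneg (v - w), sq_nonneg (u - w)]
  have hx2 : (1 - x) ^ 2 ≤ 1 := by nlinarith
  rw [Ubeta_eq α n hx.ne', mul_pow, mul_pow, mul_pow, hexp, Real.sq_sqrt (by positivity)]
  calc 1 / (((n : ℝ) + 1) * (n + 2)) * (1 - x) ^ 2 * Real.exp (-x) *
        ((α - 2) * natLag 2 n x + (n + 1) / 2 * natLag 1 (n + 1) x
          + (n + 2) / 2 * natLag 1 n x) ^ 2
      ≤ 1 / (((n : ℝ) + 1) * (n + 2)) * 1 * Real.exp (-x) *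
        (3 * (((α - 2) * natLag 2 n x) ^ 2 + ((n + 1) / 2 * natLag 1 (n + 1) x) ^ 2
          + ((n + 2) / 2 * natLag 1 n x) ^ 2)) := by
        gcongr
        exact h3 _ _ _
    _ = _ := by ring

/-- For the beta mixing setup with `a = 2`, there is a constant `c > 0`
(depending only on `α`) such that `∫_0^1 U_l² ≤ c(l ∨ 1)` for every `l ≥ 0`. -/
theorem beta_U_norm_bound (α : ℝ) (hα : 0 < α) :
    ∃ c : ℝ, 0 < c ∧ ∀ l : ℕ,
      (∫ x in Set.Ioo (0 : ℝ) 1, (Ubeta α l x) ^ 2) ≤ c * max (l : ℝ) 1 := by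
  refine ⟨3 * ((α - 2) ^ 2 + 5 / 4), by positivity, fun n => ?_⟩
  have hP := continuous_natLag 2 n
  have hQ := continuous_natLag 1 n
  have hQ' := continuous_natLag 1 (n + 1)
  have iP := integral_exp_neg_mul_natLag_two_sq_le n
  have iQ := integral_exp_neg_mul_natLag_one_sq_le n
  have iQ' := integral_exp_neg_mul_natLag_one_sq_le (n + 1)
  push_cast at iQ'
  set g : ℝ → ℝ := fun x => 3 / (((n : ℝ) + 1) * (n + 2)) *
      ((α - 2) ^ 2 * (Real.exp (-x) * natLag 2 n x ^ 2)
        + ((n + 1) / 2) ^ 2 * (Real.exp (-x) * natLag 1 (n + 1) x ^ 2)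
        + ((n + 2) / 2) ^ 2 * (Real.exp (-x) * natLag 1 n x ^ 2)) with hg
  have hgc : Continuous g := by fun_prop
  have hle : (∫ x in Set.Ioo (0 : ℝ) 1, Ubeta α n x ^ 2) ≤ ∫ x in Set.Ioo (0 : ℝ) 1, g x := by
    refine integral_mono_of_nonneg (Filter.Eventually.of_forall fun x => sq_nonneg _)
      ((hgc.integrableOn_Icc (a := 0) (b := 1)).mono_set Set.Ioo_subset_Icc_self) ?_
    filter_upwards [ae_restrict_mem measurableSet_Ioo] with x hx
    exact Ubeta_sq_le α n hx.1 hx.2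
  have hgi : ∫ x in Set.Ioo (0 : ℝ) 1, g x = 3 / (((n : ℝ) + 1) * (n + 2)) *
      ((α - 2) ^ 2 * (∫ x in (0 : ℝ)..1, Real.exp (-x) * natLag 2 n x ^ 2)
        + ((n + 1) / 2) ^ 2 * (∫ x in (0 : ℝ)..1, Real.exp (-x) * natLag 1 (n + 1) x ^ 2)
        + ((n + 2) / 2) ^ 2 * ∫ x in (0 : ℝ)..1, Real.exp (-x) * natLag 1 n x ^ 2) := by
    rw [← integral_Ioc_eq_integral_Ioo, ← intervalIntegral.integral_of_le zero_le_one, hg,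
      intervalIntegral.integral_const_mul,
      intervalIntegral.integral_add (Continuous.intervalIntegrable (by fun_prop) _ _)
        (Continuous.intervalIntegrable (by fun_prop) _ _),
      intervalIntegral.integral_add (Continuous.intervalIntegrable (by fun_prop) _ _)
        (Continuous.intervalIntegrable (by fun_prop) _ _),
      intervalIntegral.integral_const_mul, intervalIntegral.integral_const_mul,
      intervalIntegral.integral_const_mul]
  rw [hgi] at hle
  refine hle.trans ?_
  have h1 := le_max_left (n : ℝ) 1
  have h2 := le_max_right (n : ℝ) 1
  calc _ ≤ 3 / (((n : ℝ) + 1) * (n + 2)) *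
      ((α - 2) ^ 2 * ((n + 1) ^ 2 * (n + 2) / 2)
        + ((n + 1) / 2) ^ 2 * ((n : ℝ) + 1 + 1) + ((n + 2) / 2) ^ 2 * ((n : ℝ) + 1)) := by
        gcongr
    _ = 3 * ((α - 2) ^ 2 * ((n + 1) / 2) + (2 * n + 3) / 4) := by
        field_simp
        ring
    _ ≤ 3 * ((α - 2) ^ 2 * max (n : ℝ) 1 + 5 / 4 * max (n : ℝ) 1) := by
        gcongr <;> linarith
    _ = 3 * ((α - 2) ^ 2 + 5 / 4) * max (n : ℝ) 1 := by ring
end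

section
/- There exists a constant c > 0 such that for every integer l ≥ 0, ∫_0^∞ ((φ_l^{(2)})'(x))^2 dx ≤ c (l ∨ 1); that is, for the exponential mixing distribution with the choice a = 2, the functions U_l = (φ_l^{(2)})' have squared L^2-norm growing at most linearly in l. -/
open MeasureTheory Real

open Polynomial in
/-- The `k`-th Laguerre polynomial with parameter `2`, as an element of `ℝ[X]`. -/
noncomputable def laguerreTwo (l : ℕ) : ℝ[X] :=
  ∑ i ∈ Finset.range (l + 1), Polynomial.monomial i
    ((-1 : ℝ) ^ i * ((l + 2).factorial / ((i + 2).factorial * (l - i).factorial)) / i.factorial)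

lemma genLagPoly_two (l : ℕ) (x : ℝ) : genLagPoly 2 l x = (laguerreTwo l).eval x := by
  unfold genLagPoly laguerreTwo
  rw [Polynomial.eval_finsetSum]
  refine Finset.sum_congr rfl fun i _ => ?_
  rw [Polynomial.eval_monomial]
  have h1 : Real.Gamma ((l : ℝ) + 2 + 1) = (l + 2).factorial := by
    rw [← Real.Gamma_nat_eq_factorial]; push_cast; rfl
  have h2 : Real.Gamma (2 + (i : ℝ) + 1) = (i + 2).factorial := by
    rw [← Real.Gamma_nat_eq_factorial]; push_cast; ring_nf
  rw [h1, h2]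
  ring

lemma coeff_laguerreTwo (l i : ℕ) : (laguerreTwo l).coeff i =
    if i ≤ l then
      (-1 : ℝ) ^ i * ((l + 2).factorial / ((i + 2).factorial * (l - i).factorial)) / i.factorial
    else 0 := by
  simp [laguerreTwo, Polynomial.finsetSum_coeff, Polynomial.coeff_monomial]

lemma coeff_laguerreTwo_succ (l i : ℕ) :
    ((i : ℝ) + 1) * (i + 3) * (laguerreTwo l).coeff (i + 1) =
      -((l : ℝ) - i) * (laguerreTwo l).coeff i := by
  rw [coeff_laguerreTwo, coeff_laguerreTwo]
  rcases lt_trichotomy i l with h | rfl | h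
  · obtain ⟨d, rfl⟩ : ∃ d, l = i + 1 + d := ⟨l - (i + 1), by omega⟩
    rw [if_pos (by omega), if_pos (by omega)]
    have e1 : i + 1 + d - (i + 1) = d := by omega
    have e2 : i + 1 + d - i = d + 1 := by omega
    have e3 : (i + 1 + 2).factorial = (i + 3) * (i + 2).factorial := Nat.factorial_succ _
    rw [e1, e2, e3, Nat.factorial_succ d, Nat.factorial_succ i]
    have := Nat.factorial_ne_zero d
    have := Nat.factorial_ne_zero i
    have := Nat.factorial_ne_zero (i + 2)
    push_cast
    field_simp
    ring
  · simp
  · rw [if_neg (by omega), if_neg (by omega)]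
    simp

open Polynomial in
lemma laguerreTwo_ode (l : ℕ) :
    X * derivative (derivative (laguerreTwo l)) + (C 3 - X) * derivative (laguerreTwo l)
      + C (l : ℝ) * laguerreTwo l = 0 := by
  ext i
  have h := coeff_laguerreTwo_succ l i
  rw [sub_mul]
  rcases i with _ | i
  · simp [coeff_derivative, mul_coeff_zero] at h ⊢
    linarith
  · simp [coeff_derivative, coeff_X_mul, coeff_C_mul] at h ⊢
    linarith

lemma laguerreTwo_eval_zero (l : ℕ) :
    (laguerreTwo l).eval 0 = ((l : ℝ) + 1) * (l + 2) / 2 := by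
  rw [← Polynomial.coeff_zero_eq_eval_zero, coeff_laguerreTwo]
  have := Nat.factorial_ne_zero l
  simp [Nat.factorial]
  field_simp
  ring

lemma integrableOn_exp_neg_mul_pow (n : ℕ) :
    IntegrableOn (fun x : ℝ => Real.exp (-x) * x ^ n) (Set.Ioi 0) := by
  simpa using Real.GammaIntegral_convergent (s := (n : ℝ) + 1) (by positivity)

lemma integral_exp_neg_mul_pow (n : ℕ) :
    ∫ x in Set.Ioi (0 : ℝ), Real.exp (-x) * x ^ n = n.factorial := by
  rw [← Real.Gamma_nat_eq_factorial, Real.Gamma_eq_integral (by positivity)]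
  simp

lemma integrableOn_exp_neg_mul_eval (p : Polynomial ℝ) :
    IntegrableOn (fun x : ℝ => Real.exp (-x) * p.eval x) (Set.Ioi 0) := by
  induction p using Polynomial.induction_on' with
  | add p q hp hq =>
    simp only [Polynomial.eval_add, mul_add]
    exact hp.add hq
  | monomial n a =>
    simp only [Polynomial.eval_monomial]
    simpa only [IntegrableOn, mul_left_comm] using (integrableOn_exp_neg_mul_pow n).const_mul a

/-- Integration of a polynomial against the weight `e^{-x}` on `(0, ∞)`. -/
noncomputable def expIntegral : Polynomial ℝ →ₗ[ℝ] ℝ where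
  toFun p := ∫ x in Set.Ioi (0 : ℝ), Real.exp (-x) * p.eval x
  map_add' p q := by
    simp only [Polynomial.eval_add, mul_add]
    exact integral_add (integrableOn_exp_neg_mul_eval p) (integrableOn_exp_neg_mul_eval q)
  map_smul' a p := by
    simp only [Polynomial.eval_smul, smul_eq_mul, RingHom.id_apply]
    rw [← integral_const_mul]
    congr 1 with x
    ring

lemma expIntegral_apply (p : Polynomial ℝ) :
    expIntegral p = ∫ x in Set.Ioi (0 : ℝ), Real.exp (-x) * p.eval x := rfl

lemma expIntegral_sq_nonneg (p : Polynomial ℝ) : 0 ≤ expIntegral (p * p) := by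
  rw [expIntegral_apply]
  refine setIntegral_nonneg measurableSet_Ioi fun x _ => ?_
  rw [Polynomial.eval_mul]
  exact mul_nonneg (Real.exp_pos _).le (mul_self_nonneg _)

lemma expIntegral_C_mul (a : ℝ) (p : Polynomial ℝ) :
    expIntegral (Polynomial.C a * p) = a * expIntegral p := by
  rw [← Polynomial.smul_eq_C_mul, map_smul, smul_eq_mul]

lemma expIntegral_monomial (n : ℕ) (a : ℝ) :
    expIntegral (Polynomial.monomial n a) = a * n.factorial := by
  rw [← Polynomial.C_mul_X_pow_eq_monomial, expIntegral_C_mul, expIntegral_apply,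
    ← integral_exp_neg_mul_pow]
  simp

lemma expIntegral_derivative (p : Polynomial ℝ) :
    expIntegral (Polynomial.derivative p) = expIntegral p - p.eval 0 := by
  induction p using Polynomial.induction_on' with
  | add p q hp hq =>
    rw [Polynomial.derivative_add, map_add, map_add, Polynomial.eval_add, hp, hq]
    ring
  | monomial n a =>
    rw [Polynomial.derivative_monomial, expIntegral_monomial, expIntegral_monomial]
    rcases n with _ | n
    · simp
    · simp [Nat.factorial_succ]
      ring

section moments

open Polynomial

lemma expIntegral_pow_mul_derivative (n : ℕ) (p : ℝ[X]) :
    expIntegral (X ^ (n + 1) * derivative p) =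
      expIntegral (X ^ (n + 1) * p) - (n + 1) * expIntegral (X ^ n * p) := by
  have h := expIntegral_derivative (X ^ (n + 1) * p)
  have e : derivative (X ^ (n + 1) * p) =
      C ((n : ℝ) + 1) * (X ^ n * p) + X ^ (n + 1) * derivative p := by
    rw [derivative_mul, derivative_X_pow]
    simp
    ring
  rw [e, map_add, expIntegral_C_mul] at h
  simp at h
  linarith

lemma expIntegral_pow_mul_ode (l m : ℕ) :
    (1 - (m : ℝ)) * expIntegral (X ^ (m + 1) * derivative (laguerreTwo l)) +
      l * expIntegral (X ^ (m + 1) * laguerreTwo l) = 0 := by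
  have h := congrArg expIntegral (congrArg (X ^ (m + 1) * ·) (laguerreTwo_ode l))
  have e : X ^ (m + 1) * (X * derivative (derivative (laguerreTwo l))
      + (C 3 - X) * derivative (laguerreTwo l) + C (l : ℝ) * laguerreTwo l) =
      X ^ (m + 1 + 1) * derivative (derivative (laguerreTwo l))
      + C 3 * (X ^ (m + 1) * derivative (laguerreTwo l))
      - X ^ (m + 1 + 1) * derivative (laguerreTwo l)
      + C (l : ℝ) * (X ^ (m + 1) * laguerreTwo l) := by ring
  simp only [e, mul_zero, map_zero, map_add, map_sub, expIntegral_C_mul,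
    expIntegral_pow_mul_derivative (m + 1) (derivative (laguerreTwo l))] at h
  push_cast at h
  linarith

lemma expIntegral_pow_succ_mul_laguerreTwo (l m : ℕ) :
    ((l : ℝ) + 1 - m) * expIntegral (X ^ (m + 1) * laguerreTwo l) =
      (1 - (m : ℝ)) * (m + 1) * expIntegral (X ^ m * laguerreTwo l) := by
  have h := expIntegral_pow_mul_ode l m
  rw [expIntegral_pow_mul_derivative] at h
  linarith

lemma expIntegral_pow_add_two_mul_laguerreTwo (l m : ℕ) (h : m < l) :
    expIntegral (X ^ (m + 2) * laguerreTwo l) = 0 := by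
  induction m with
  | zero =>
    have h1 := expIntegral_pow_succ_mul_laguerreTwo l 1
    have : (l : ℝ) ≠ 0 := by exact_mod_cast h.ne'
    simpa [this] using h1
  | succ m ih =>
    have h1 := expIntegral_pow_succ_mul_laguerreTwo l (m + 2)
    rw [ih (by omega), mul_zero] at h1
    refine (mul_eq_zero.mp h1).resolve_left ?_
    have : ((m + 1 : ℕ) : ℝ) < l := by exact_mod_cast h
    push_cast at this ⊢
    linarith

lemma expIntegral_laguerreTwo (l : ℕ) : expIntegral (laguerreTwo l) = l + 1 := by
  have h := congrArg expIntegral (laguerreTwo_ode l)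
  have e : X * derivative (derivative (laguerreTwo l))
      + (C 3 - X) * derivative (laguerreTwo l) + C (l : ℝ) * laguerreTwo l =
      X ^ (0 + 1) * derivative (derivative (laguerreTwo l))
      + C 3 * derivative (laguerreTwo l)
      - X ^ (0 + 1) * derivative (laguerreTwo l) + C (l : ℝ) * laguerreTwo l := by ring
  simp only [e, map_zero, map_add, map_sub, expIntegral_C_mul,
    expIntegral_pow_mul_derivative 0 (derivative (laguerreTwo l))] at h
  simp only [pow_zero, one_mul, expIntegral_derivative, laguerreTwo_eval_zero] at h
  have hl : (l : ℝ) + 2 ≠ 0 := by positivity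
  apply mul_left_cancel₀ hl
  push_cast at h
  linarith

lemma expIntegral_X_mul_laguerreTwo (l : ℕ) : expIntegral (X * laguerreTwo l) = 1 := by
  have h := expIntegral_pow_succ_mul_laguerreTwo l 0
  simp [expIntegral_laguerreTwo] at h
  have hl : (l : ℝ) + 1 ≠ 0 := by positivity
  exact mul_left_cancel₀ hl (by linarith)

lemma expIntegral_X_mul_laguerreTwo_sq (l : ℕ) :
    expIntegral (X * laguerreTwo l * laguerreTwo l) = ((l : ℝ) + 1) * (l + 2) / 2 := by
  have e : X * laguerreTwo l * laguerreTwo l = ∑ i ∈ Finset.range (l + 1),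
      C ((laguerreTwo l).coeff i) * (X ^ (i + 1) * laguerreTwo l) := by
    have hd : (laguerreTwo l).natDegree < l + 1 := by
      rw [Nat.lt_succ_iff, natDegree_le_iff_coeff_eq_zero]
      intro N hN
      rw [coeff_laguerreTwo, if_neg (by omega)]
    have hs := (laguerreTwo l).as_sum_range' (l + 1) hd
    calc X * laguerreTwo l * laguerreTwo l
        = (∑ i ∈ Finset.range (l + 1), monomial i ((laguerreTwo l).coeff i)) *
          (X * laguerreTwo l) := by rw [← hs]; ring
      _ = _ := by
        rw [Finset.sum_mul]
        refine Finset.sum_congr rfl fun i _ => ?_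
        rw [← C_mul_X_pow_eq_monomial]
        ring
  rw [e, map_sum, Finset.sum_range_succ']
  simp only [expIntegral_C_mul]
  rw [Finset.sum_eq_zero, zero_add, zero_add, pow_one, expIntegral_X_mul_laguerreTwo, mul_one,
    coeff_zero_eq_eval_zero, laguerreTwo_eval_zero]
  intro i hi
  rw [expIntegral_pow_add_two_mul_laguerreTwo l i (Finset.mem_range.mp hi), mul_zero]

/-- A bound for the squared weighted norm of the derivative of `P` minus half of `P`, where
`P = X * laguerreTwo l`. -/
lemma expIntegral_deriv_sq_le (l : ℕ) :
    expIntegral ((derivative (X * laguerreTwo l) - C (1 / 2) * (X * laguerreTwo l)) *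
      (derivative (X * laguerreTwo l) - C (1 / 2) * (X * laguerreTwo l))) ≤
      ((l : ℝ) + 3 / 2) * (((l : ℝ) + 1) * (l + 2) / 2) := by
  rw [← expIntegral_X_mul_laguerreTwo_sq]
  have ode := laguerreTwo_ode l
  set Q := laguerreTwo l
  have hP := expIntegral_sq_nonneg (X * Q)
  have hQ := expIntegral_sq_nonneg Q
  have i1 := expIntegral_derivative (X * Q * (X * Q))
  have i2 := expIntegral_derivative (X * Q * derivative (X * Q))
  have i3 := expIntegral_derivative (X * Q * Q)
  have e1 : derivative (X * Q * (X * Q)) = C 2 * (X * Q * derivative (X * Q)) := by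
    rw [derivative_mul (f := X * Q), show (C 2 : ℝ[X]) = 2 from rfl]; ring
  have e2 : derivative (X * Q * derivative (X * Q)) =
      derivative (X * Q) * derivative (X * Q) + X * Q * derivative (X * Q)
      - X * Q * derivative Q - C (l : ℝ) * (X * Q * Q) - X * Q * Q := by
    simp only [derivative_mul, derivative_X, derivative_add, one_mul]
    have h3 : (C 3 : ℝ[X]) = 3 := rfl
    rw [h3] at ode
    linear_combination X * Q * ode
  have e3 : derivative (X * Q * Q) = Q * Q + C 2 * (X * Q * derivative Q) := by
    simp only [derivative_mul, derivative_X, one_mul]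
    rw [show (C 2 : ℝ[X]) = 2 from rfl]; ring
  have e4 : (derivative (X * Q) - C (1 / 2) * (X * Q)) *
      (derivative (X * Q) - C (1 / 2) * (X * Q)) =
      derivative (X * Q) * derivative (X * Q) - X * Q * derivative (X * Q)
      + C (1 / 4) * (X * Q * (X * Q)) := by
    have h2 : (C (1 / 2) : ℝ[X]) + C (1 / 2) = 1 := by rw [← C_add, add_halves, C_1]
    rw [show (1 / 4 : ℝ) = (1 / 2) * (1 / 2) by norm_num, C_mul]
    linear_combination -(X * Q * derivative (X * Q)) * h2
  rw [e1] at i1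
  rw [e2] at i2
  rw [e3] at i3
  rw [e4]
  simp only [map_add, map_sub, expIntegral_C_mul, eval_mul, eval_X, zero_mul] at i1 i2 i3 ⊢
  linarith

end moments

lemma deriv_lagFun_two (l : ℕ) (x : ℝ) :
    deriv (lagFun 2 l) x = Real.sqrt ((l.factorial : ℝ) / (l + 2).factorial) *
      (Real.exp (-x / 2) * (Polynomial.derivative (Polynomial.X * laguerreTwo l) -
        Polynomial.C (1 / 2) * (Polynomial.X * laguerreTwo l)).eval x) := by
  have hG : Real.Gamma ((l : ℝ) + 2 + 1) = (l + 2).factorial := by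
    rw [← Real.Gamma_nat_eq_factorial]; push_cast; rfl
  have hf : lagFun 2 l = fun y => Real.sqrt ((l.factorial : ℝ) / (l + 2).factorial) *
      (Real.exp (-y / 2) * (Polynomial.X * laguerreTwo l).eval y) := by
    funext y
    rw [lagFun, genLagPoly_two, hG, div_self two_ne_zero, Real.rpow_one, Polynomial.eval_mul,
      Polynomial.eval_X]
    ring
  have he : HasDerivAt (fun y : ℝ => Real.exp (-y / 2)) (Real.exp (-x / 2) * (-1 / 2)) x :=
    ((hasDerivAt_neg x).div_const 2).exp
  rw [hf, ((he.fun_mul ((Polynomial.X * laguerreTwo l).hasDerivAt x)).const_mul _).deriv]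
  rw [Polynomial.eval_sub, Polynomial.eval_mul (p := Polynomial.C _), Polynomial.eval_C]
  ring

/-- There is a constant `c > 0` such that for every `l ≥ 0`,
`∫_0^∞ ((φ_l^{(2)})′(x))²dx ≤ c(l ∨ 1)`: for the exponential mixing distribution with
`a = 2`, the functions `U_l = (φ_l^{(2)})′` have squared `L²`-norm growing at most linearly. -/
theorem exponential_U_norm_bound :
    ∃ c : ℝ, 0 < c ∧ ∀ l : ℕ,
      (∫ x in Set.Ioi (0 : ℝ), (deriv (lagFun 2 l) x) ^ 2) ≤ c * max (l : ℝ) 1 := by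
  refine ⟨5 / 4, by norm_num, fun l => ?_⟩
  set R := Polynomial.derivative (Polynomial.X * laguerreTwo l) -
    Polynomial.C (1 / 2) * (Polynomial.X * laguerreTwo l) with hR
  have hint : (∫ x in Set.Ioi (0 : ℝ), (deriv (lagFun 2 l) x) ^ 2) =
      (l.factorial : ℝ) / (l + 2).factorial * expIntegral (R * R) := by
    rw [expIntegral_apply, ← integral_const_mul]
    congr 1 with x
    rw [deriv_lagFun_two, mul_pow, Real.sq_sqrt (by positivity), mul_pow, ← Real.exp_nat_mul,
      Polynomial.eval_mul, ← hR]
    push_cast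
    rw [show 2 * (-x / 2) = -x by ring]
    ring
  have hfac : ((l + 2).factorial : ℝ) = (l + 2) * (l + 1) * l.factorial := by
    rw [Nat.factorial_succ, Nat.factorial_succ]
    push_cast
    ring
  rw [hint]
  calc (l.factorial : ℝ) / (l + 2).factorial * expIntegral (R * R)
      ≤ (l.factorial : ℝ) / (l + 2).factorial *
        (((l : ℝ) + 3 / 2) * (((l : ℝ) + 1) * (l + 2) / 2)) :=
        mul_le_mul_of_nonneg_left (expIntegral_deriv_sq_le l) (by positivity)
    _ = ((l : ℝ) + 3 / 2) / 2 := by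
        have := Nat.factorial_ne_zero l
        rw [hfac]
        field_simp
    _ ≤ 5 / 4 * max (l : ℝ) 1 := by
        linarith [le_max_left (l : ℝ) 1, le_max_right (l : ℝ) 1]
end

section
/- For the Weibull mixing distribution q(x|θ) = αθ x^{α−1} e^{−x^α θ} on (0,∞) with known shape α > 0 and unknown scale θ > 0: for every a > 0, every θ > 0 and every integer l ≥ 0, the function U_l(x) = (α x^{α−1})^{−1}(φ_l^{(a)})'(x) satisfies ∫_0^∞ x^{α−1} e^{−x^α θ} U_l(x)dx = θ ∫_0^∞ x^{α−1} e^{−x^α θ} φ_l^{(a)}(x)dx; equivalently, ∫_0^∞ q(x|θ)U_l(x)dx = θ ∫_0^∞ q(x|θ)φ_l^{(a)}(x)dx. (The case α = 2 gives the corresponding identity for the Rayleigh mixing distribution q(x|θ) = θ x e^{−x^2θ/2} with U_l(x) = x^{−1}(φ_l^{(a)})'(x), up to the reparametrization of θ.) -/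
open MeasureTheory Real

/-- `U_l` for the Weibull mixing distribution: `U_l(x) = (αx^{α−1})⁻¹(φ_l^{(a)})′(x)`. -/
noncomputable def Uweibull (α a : ℝ) (l : ℕ) (x : ℝ) : ℝ :=
  (α * x ^ (α - 1))⁻¹ * deriv (lagFun a l) x

/-- The derivative of `x ↦ x ^ b * exp (-(1 / 2) * x)` on `x > 0`. -/
noncomputable def rpowExpDeriv (b x : ℝ) : ℝ :=
  b * (x ^ (b - 1) * Real.exp (-(1 / 2) * x)) - 1 / 2 * (x ^ b * Real.exp (-(1 / 2) * x))

lemma hasDerivAt_rpow_mul_exp (b : ℝ) {x : ℝ} (hx : 0 < x) :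
    HasDerivAt (fun y : ℝ => y ^ b * Real.exp (-(1 / 2) * y)) (rpowExpDeriv b x) x := by
  have h1 := Real.hasDerivAt_rpow_const (p := b) (Or.inl hx.ne')
  have h2 := ((hasDerivAt_id x).const_mul (-(1 / 2) : ℝ)).exp
  refine (h1.mul h2).congr_deriv ?_
  simp only [rpowExpDeriv, id]
  ring

lemma integrableOn_rpow_mul_exp_neg_half {s : ℝ} (hs : -1 < s) :
    IntegrableOn (fun x : ℝ => x ^ s * Real.exp (-(1 / 2) * x)) (Set.Ioi 0) := by
  simpa using integrableOn_rpow_mul_exp_neg_mul_rpow (b := 1 / 2) hs one_pos (by norm_num)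

lemma integrableOn_rpowExpDeriv {b : ℝ} (hb : 0 < b) :
    IntegrableOn (rpowExpDeriv b) (Set.Ioi 0) :=
  ((integrableOn_rpow_mul_exp_neg_half (by linarith)).const_mul b).sub
    ((integrableOn_rpow_mul_exp_neg_half (by linarith)).const_mul (1 / 2))

lemma lagFun_eq_sum (a : ℝ) (l : ℕ) : ∃ c : ℕ → ℝ, ∀ x : ℝ, 0 < x →
    lagFun a l x = ∑ i ∈ Finset.range (l + 1),
      c i * (x ^ (a / 2 + i) * Real.exp (-(1 / 2) * x)) := by
  refine ⟨fun i => Real.sqrt ((Nat.factorial l : ℝ) / Real.Gamma ((l : ℝ) + a + 1)) *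
    ((-1 : ℝ) ^ i * (Real.Gamma ((l : ℝ) + a + 1) /
      (Real.Gamma (a + i + 1) * (Nat.factorial (l - i)))) / (Nat.factorial i)), fun x hx => ?_⟩
  rw [lagFun, genLagPoly, Finset.mul_sum]
  refine Finset.sum_congr rfl fun i _ => ?_
  rw [Real.rpow_add_natCast hx.ne', show -x / 2 = -(1 / 2) * x by ring]
  ring

lemma integrableOn_exp_neg_rpow_mul {α θ : ℝ} (hθ : 0 < θ) {f : ℝ → ℝ}
    (hf : IntegrableOn f (Set.Ioi 0)) :
    IntegrableOn (fun x : ℝ => Real.exp (-(x ^ α * θ)) * f x) (Set.Ioi 0) := by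
  refine Integrable.bdd_mul (c := 1) hf (by fun_prop) ?_
  filter_upwards [ae_restrict_mem measurableSet_Ioi] with x hx
  rw [Real.norm_eq_abs, Real.abs_exp, Real.exp_le_one_iff]
  have : 0 ≤ x ^ α * θ := mul_nonneg (Real.rpow_nonneg (le_of_lt hx) _) hθ.le
  linarith

lemma tendsto_exp_neg_rpow_mul_zero {α θ : ℝ} (hθ : 0 < θ) {f : ℝ → ℝ} {F : Filter ℝ}
    (hF : ∀ᶠ x in F, 0 < x) (hf : Filter.Tendsto f F (nhds 0)) :
    Filter.Tendsto (fun x : ℝ => Real.exp (-(x ^ α * θ)) * f x) F (nhds 0) := by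
  refine squeeze_zero_norm' ?_ (tendsto_norm_zero.comp hf)
  filter_upwards [hF] with x hx
  have : 0 ≤ x ^ α * θ := mul_nonneg (Real.rpow_nonneg hx.le _) hθ.le
  rw [norm_mul, Real.norm_eq_abs, Real.abs_exp]
  exact mul_le_of_le_one_left (norm_nonneg _) (Real.exp_le_one_iff.2 (by linarith))

lemma integral_exp_neg_rpow_mul_deriv_lagFun {α a θ : ℝ} (hα : 0 < α) (ha : 0 < a)
    (hθ : 0 < θ) (l : ℕ) :
    ∫ x in Set.Ioi (0 : ℝ), Real.exp (-(x ^ α * θ)) * deriv (lagFun a l) x =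
      α * θ * ∫ x in Set.Ioi (0 : ℝ),
        x ^ (α - 1) * Real.exp (-(x ^ α * θ)) * lagFun a l x := by
  obtain ⟨c, hc⟩ := lagFun_eq_sum a l
  have hb (i : ℕ) : 0 < a / 2 + i := by positivity
  have hderiv {x : ℝ} (hx : 0 < x) : HasDerivAt (lagFun a l)
      (∑ i ∈ Finset.range (l + 1), c i * rpowExpDeriv (a / 2 + i) x) x := by
    refine (HasDerivAt.fun_sum fun (i : ℕ) _ =>
      (hasDerivAt_rpow_mul_exp (a / 2 + i) hx).const_mul (c i)).congr_of_eventuallyEq ?_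
    filter_upwards [lt_mem_nhds hx] with y hy using hc y hy
  have hexp {x : ℝ} (hx : 0 < x) : HasDerivAt (fun y : ℝ => Real.exp (-(y ^ α * θ)))
      (-(α * θ) * (x ^ (α - 1) * Real.exp (-(x ^ α * θ)))) x := by
    refine (((Real.hasDerivAt_rpow_const (p := α) (Or.inl hx.ne')).mul_const
      θ).fun_neg.exp).congr_deriv ?_
    ring
  have hint_deriv : IntegrableOn (deriv (lagFun a l)) (Set.Ioi 0) := by
    have h : IntegrableOn
        (fun x => ∑ i ∈ Finset.range (l + 1), c i * rpowExpDeriv (a / 2 + i) x) (Set.Ioi 0) :=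
      integrable_finsetSum _ fun i _ => (integrableOn_rpowExpDeriv (hb i)).const_mul (c i)
    exact h.congr_fun (fun x hx => (hderiv hx).deriv.symm) measurableSet_Ioi
  have hint : IntegrableOn (fun x => x ^ (α - 1) * lagFun a l x) (Set.Ioi 0) := by
    have h : IntegrableOn (fun x : ℝ => ∑ i ∈ Finset.range (l + 1),
        c i * (x ^ (α - 1 + (a / 2 + i)) * Real.exp (-(1 / 2) * x))) (Set.Ioi 0) :=
      integrable_finsetSum _ fun i _ => (integrableOn_rpow_mul_exp_neg_half
        (by linarith [hb i])).const_mul (c i)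
    refine h.congr_fun (fun x hx => ?_) measurableSet_Ioi
    simp only [hc x hx, Finset.mul_sum]
    refine Finset.sum_congr rfl fun i _ => ?_
    rw [Real.rpow_add hx]
    ring
  have hlim {F : Filter ℝ} (hF : ∀ᶠ x in F, 0 < x)
      (h : ∀ i : ℕ, Filter.Tendsto
        (fun x : ℝ => x ^ (a / 2 + i) * Real.exp (-(1 / 2) * x)) F (nhds 0)) :
      Filter.Tendsto ((fun x : ℝ => Real.exp (-(x ^ α * θ))) * lagFun a l) F (nhds 0) := by
    refine tendsto_exp_neg_rpow_mul_zero hθ hF ?_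
    have hs := tendsto_finsetSum (Finset.range (l + 1)) fun i _ => (h i).const_mul (c i)
    simp only [mul_zero, Finset.sum_const_zero] at hs
    refine hs.congr' ?_
    filter_upwards [hF] with x hx using (hc x hx).symm
  have hzero := hlim (F := nhdsWithin 0 (Set.Ioi 0)) self_mem_nhdsWithin fun i => by
    have hcont : Continuous fun x : ℝ => x ^ (a / 2 + i) * Real.exp (-(1 / 2) * x) :=
      (Real.continuous_rpow_const (hb i).le).mul (by fun_prop)
    have h := hcont.tendsto 0
    rw [Real.zero_rpow (hb i).ne', zero_mul] at h
    exact h.mono_left nhdsWithin_le_nhds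
  have htop := hlim (Filter.eventually_gt_atTop 0) fun i =>
    tendsto_rpow_mul_exp_neg_mul_atTop_nhds_zero _ _ one_half_pos
  have key := integral_Ioi_mul_deriv_eq_deriv_mul
    (fun x hx => hexp hx) (fun x hx => (hderiv hx).differentiableAt.hasDerivAt)
    (integrableOn_exp_neg_rpow_mul hθ hint_deriv)
    (by
      refine IntegrableOn.congr_fun
        ((integrableOn_exp_neg_rpow_mul (α := α) hθ hint).const_mul (-(α * θ)))
        (fun x _ => ?_) measurableSet_Ioi
      simp only [Pi.mul_apply]
      ring) hzero htop
  rw [key, ← integral_const_mul, sub_zero, zero_sub, ← integral_neg]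
  congr 1 with x
  ring

/-- For the Weibull mixing distribution `q(x|θ) = αθx^{α−1}e^{−x^αθ}` with
`α > 0`: for every `a > 0`, `θ > 0` and `l ≥ 0`, the function
`U_l(x) = (αx^{α−1})⁻¹(φ_l^{(a)})′(x)` satisfies
`∫_0^∞ x^{α−1}e^{−x^αθ}U_l(x)dx = θ∫_0^∞ x^{α−1}e^{−x^αθ}φ_l^{(a)}(x)dx`; equivalently,
`∫_0^∞ q(x|θ)U_l(x)dx = θ∫_0^∞ q(x|θ)φ_l^{(a)}(x)dx`. -/
theorem weibull_U_identity (α : ℝ) (hα : 0 < α) (a : ℝ) (ha : 0 < a)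
    (θ : ℝ) (hθ : 0 < θ) (l : ℕ) :
    ((∫ x in Set.Ioi (0 : ℝ), x ^ (α - 1) * Real.exp (-(x ^ α * θ)) * Uweibull α a l x) =
        θ * ∫ x in Set.Ioi (0 : ℝ), x ^ (α - 1) * Real.exp (-(x ^ α * θ)) * lagFun a l x) ∧
      ((∫ x in Set.Ioi (0 : ℝ),
          α * θ * x ^ (α - 1) * Real.exp (-(x ^ α * θ)) * Uweibull α a l x) =
        θ * ∫ x in Set.Ioi (0 : ℝ),
          α * θ * x ^ (α - 1) * Real.exp (-(x ^ α * θ)) * lagFun a l x) := by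
  have key := integral_exp_neg_rpow_mul_deriv_lagFun hα ha hθ l
  have hU : (∫ x in Set.Ioi (0 : ℝ),
      x ^ (α - 1) * Real.exp (-(x ^ α * θ)) * Uweibull α a l x) =
        θ * ∫ x in Set.Ioi (0 : ℝ),
          x ^ (α - 1) * Real.exp (-(x ^ α * θ)) * lagFun a l x := by
    calc
      _ = ∫ x in Set.Ioi (0 : ℝ),
          α⁻¹ * (Real.exp (-(x ^ α * θ)) * deriv (lagFun a l) x) := by
        refine setIntegral_congr_fun measurableSet_Ioi fun x hx => ?_
        have hx' : x ^ (α - 1) ≠ 0 := (Real.rpow_pos_of_pos hx _).ne'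
        simp only [Uweibull]
        field_simp
      _ = _ := by
        rw [integral_const_mul, key]
        field_simp
  refine ⟨hU, ?_⟩
  simp only [mul_assoc] at hU ⊢
  simp only [integral_const_mul, hU]
  ring
end
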